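/- arXiv:1708.03121 — 10 statements merged into one kernel-verified Lean document; each statement's English description precedes it below -/
import Mathlib

section
/- For every finite simple graph G, χ_id(G) ≤ χ_id(G\R). That is, if the maximal twin-free induced subgraph G\R of G admits an identifying coloring with n colors, then G admits an identifying coloring with at most n colors. -/
open SimpleGraph

variable {V : Type*}

/-- The closed neighborhood `N[u]` of a vertex `u`. -/
def closedNbhd (G : SimpleGraph V) (u : V) : Set V := insert u (G.neighborSet u)

/-- Two vertices are twins if they have the same closed neighborhood. -/
def Twins (G : SimpleGraph V) (u v : V) : Prop := closedNbhd G u = closedNbhd G v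

/-- `c` is an identifying coloring of `G`: every pair of non-twin vertices gets
distinct color sets on their closed neighborhoods. -/
def IsIdColoring {α : Type*} (G : SimpleGraph V) (c : V → α) : Prop :=
  ∀ u v : V, ¬ Twins G u v → c '' closedNbhd G u ≠ c '' closedNbhd G v

/-- `χ_id(G)`: the minimum number of colors in an identifying coloring of `G`. -/
noncomputable def chiId (G : SimpleGraph V) : ℕ :=
  sInf {n | ∃ c : V → Fin n, IsIdColoring G c}

/-- `s` is a set of representatives of the twin-equivalence classes of `G`:
it contains exactly one vertex from each class. The induced subgraph of `G` on
such a set is the maximal twin-free induced subgraph `G\R` (the quotient of `G`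
by the twin relation `R`), well-defined up to isomorphism. -/
def IsRepSet (G : SimpleGraph V) (s : Finset V) : Prop :=
  ∀ v : V, ∃! w, w ∈ s ∧ Twins G v w

theorem mem_closedNbhd_comm {G : SimpleGraph V} {u v : V} :
    u ∈ closedNbhd G v ↔ v ∈ closedNbhd G u := by
  simp only [closedNbhd, Set.mem_insert_iff, mem_neighborSet, eq_comm, G.adj_comm]

theorem Twins.mem_closedNbhd_iff {G : SimpleGraph V} {u v : V} (h : Twins G u v) (w : V) :
    u ∈ closedNbhd G w ↔ v ∈ closedNbhd G w := by
  rw [mem_closedNbhd_comm, h, mem_closedNbhd_comm]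

theorem mem_closedNbhd_induce {G : SimpleGraph V} {s : Set V} {u v : s} :
    u ∈ closedNbhd (G.induce s) v ↔ (u : V) ∈ closedNbhd G v := by
  simp [closedNbhd, Subtype.ext_iff]

theorem isIdColoring_of_injective {α : Type*} (G : SimpleGraph V) {c : V → α}
    (hc : Function.Injective c) : IsIdColoring G c :=
  fun _ _ h h' => h (hc.image_injective h')

theorem exists_isIdColoring_chiId [Finite V] (G : SimpleGraph V) :
    ∃ c : V → Fin (chiId G), IsIdColoring G c :=
  Nat.sInf_mem (s := {n | ∃ c : V → Fin n, IsIdColoring G c})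
    ⟨Nat.card V, Finite.equivFin V, isIdColoring_of_injective G (Finite.equivFin V).injective⟩

/-- A map sending each vertex to a twin in `s` and fixing `s` pulls identifying colorings of
the subgraph induced on `s` back to identifying colorings of the whole graph. -/
theorem IsIdColoring.comp_twin {α : Type*} {G : SimpleGraph V} {s : Set V} {c : s → α}
    (hc : IsIdColoring (G.induce s) c) (r : V → s) (hr : ∀ v, Twins G v (r v))
    (hfix : ∀ w : s, r w = w) : IsIdColoring G (c ∘ r) := by
  have himage (v : V) : r '' closedNbhd G v = closedNbhd (G.induce s) (r v) := by
    ext w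
    rw [mem_closedNbhd_induce, ← show closedNbhd G v = closedNbhd G (r v) from hr v]
    constructor
    · rintro ⟨x, hx, rfl⟩
      exact ((hr x).mem_closedNbhd_iff v).1 hx
    · exact fun hw => ⟨w, hw, hfix w⟩
  intro u v huv
  rw [Set.image_comp, Set.image_comp, himage, himage]
  refine hc _ _ fun h => huv ?_
  ext x
  rw [(hr x).mem_closedNbhd_iff, (hr x).mem_closedNbhd_iff,
    show closedNbhd G u = closedNbhd G (r u) from hr u,
    show closedNbhd G v = closedNbhd G (r v) from hr v,
    ← mem_closedNbhd_induce, ← mem_closedNbhd_induce, h]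

/-- For every finite simple graph `G`, `χ_id(G) ≤ χ_id(G\R)`. -/
theorem chiId_le_chiId_quotient [Fintype V] (G : SimpleGraph V)
    (s : Finset V) (hs : IsRepSet G s) :
    chiId G ≤ chiId (G.induce (↑s : Set V)) := by
  obtain ⟨c, hc⟩ := exists_isIdColoring_chiId (G.induce (↑s : Set V))
  choose r hr using fun v => (hs v).exists
  exact Nat.sInf_le ⟨_, hc.comp_twin (fun v => ⟨r v, (hr v).1⟩) (fun v => (hr v).2)
    fun w => Subtype.ext ((hs w).unique (hr w) ⟨w.2, rfl⟩)⟩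
end

section
/- For every integer p ≥ 1, χ_id(H_p) = p + 2. -/
open SimpleGraph

variable {V : Type*}

/-- The split graph `H_p`: `Sum.inl i` is the independent vertex `s_{i+1}`
(for `i : Fin p`, representing `s_1, …, s_p`) and `Sum.inr j` is the clique
vertex `k_j` (for `j : Fin (p+1)`, representing `k_0, …, k_p`); besides the
clique edges, the only other edges are `s_{i+1} k_{i+1}` for `i = 0, …, p-1`. -/
def Hp (p : ℕ) : SimpleGraph (Fin p ⊕ Fin (p + 1)) :=
  SimpleGraph.fromRel (fun a b =>
    match a, b with
    | Sum.inr _, Sum.inr _ => True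
    | Sum.inl i, Sum.inr j => (j : ℕ) = (i : ℕ) + 1
    | _, _ => False)

theorem closedNbhd_Hp_inr_zero (p : ℕ) :
    closedNbhd (Hp p) (Sum.inr 0) = Set.range Sum.inr := by
  ext x
  rcases x with i | j
  · simp [closedNbhd, Hp]
  · simpa [closedNbhd, Hp] using (em (j = 0)).imp id Ne.symm

theorem closedNbhd_Hp_inr_succ {p : ℕ} (i : Fin p) :
    closedNbhd (Hp p) (Sum.inr i.succ) = insert (Sum.inl i) (Set.range Sum.inr) := by
  ext x
  rcases x with k | j
  · simp [closedNbhd, Hp, Fin.ext_iff, eq_comm]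
  · simpa [closedNbhd, Hp] using (em (j = i.succ)).imp id Ne.symm

theorem closedNbhd_Hp_inl {p : ℕ} (i : Fin p) :
    closedNbhd (Hp p) (Sum.inl i) = {Sum.inl i, Sum.inr i.succ} := by
  ext x
  rcases x with k | j <;> simp [closedNbhd, Hp, Fin.ext_iff]

theorem image_closedNbhd_Hp_inr_zero {p : ℕ} {α : Type*} (c : Fin p ⊕ Fin (p + 1) → α) :
    c '' closedNbhd (Hp p) (Sum.inr 0) = Set.range (c ∘ Sum.inr) := by
  rw [closedNbhd_Hp_inr_zero, Set.range_comp]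

theorem image_closedNbhd_Hp_inr_succ {p : ℕ} {α : Type*} (c : Fin p ⊕ Fin (p + 1) → α)
    (i : Fin p) :
    c '' closedNbhd (Hp p) (Sum.inr i.succ) =
      insert (c (Sum.inl i)) (Set.range (c ∘ Sum.inr)) := by
  rw [closedNbhd_Hp_inr_succ, Set.image_insert_eq, Set.range_comp]

theorem image_closedNbhd_Hp_inl {p : ℕ} {α : Type*} (c : Fin p ⊕ Fin (p + 1) → α)
    (i : Fin p) :
    c '' closedNbhd (Hp p) (Sum.inl i) = {c (Sum.inl i), c (Sum.inr i.succ)} := by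
  rw [closedNbhd_Hp_inl, Set.image_pair]

/-- The vertices `s_i` receive colors that do not occur on the clique. -/
theorem IsIdColoring.inl_ne_inr {p : ℕ} {α : Type*} {c : Fin p ⊕ Fin (p + 1) → α}
    (hc : IsIdColoring (Hp p) c) (i : Fin p) (j : Fin (p + 1)) :
    c (Sum.inl i) ≠ c (Sum.inr j) := by
  intro h
  refine hc (Sum.inr i.succ) (Sum.inr 0) (fun ht => ?_) ?_
  · rw [Twins, closedNbhd_Hp_inr_zero, closedNbhd_Hp_inr_succ] at ht
    simpa using ht.subset (Set.mem_insert _ _)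
  · rw [image_closedNbhd_Hp_inr_zero, image_closedNbhd_Hp_inr_succ]
    exact Set.insert_eq_of_mem ⟨j, h.symm⟩

/-- The vertices `s_i` receive pairwise distinct colors. -/
theorem IsIdColoring.inl_injective {p : ℕ} {α : Type*} {c : Fin p ⊕ Fin (p + 1) → α}
    (hc : IsIdColoring (Hp p) c) : Function.Injective (c ∘ Sum.inl) := by
  intro i j h
  by_contra hij
  refine hc (Sum.inr i.succ) (Sum.inr j.succ) (fun ht => hij ?_) ?_
  · rw [Twins, closedNbhd_Hp_inr_succ, closedNbhd_Hp_inr_succ] at ht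
    simpa using ht.subset (Set.mem_insert _ _)
  · rw [image_closedNbhd_Hp_inr_succ, image_closedNbhd_Hp_inr_succ]
    exact congrArg (insert · _) h

/-- At least two colors occur on the clique. -/
theorem IsIdColoring.exists_inr_ne {p : ℕ} (hp : 1 ≤ p) {α : Type*}
    {c : Fin p ⊕ Fin (p + 1) → α} (hc : IsIdColoring (Hp p) c) :
    ∃ j, c (Sum.inr j) ≠ c (Sum.inr 0) := by
  by_contra! h
  let i : Fin p := ⟨0, hp⟩
  refine hc (Sum.inr i.succ) (Sum.inl i) (fun ht => ?_) ?_
  · rw [Twins, closedNbhd_Hp_inr_succ, closedNbhd_Hp_inl] at ht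
    have h0 := ht.subset (Set.mem_insert_of_mem _ ⟨0, rfl⟩)
    simp [Fin.ext_iff] at h0
  · rw [image_closedNbhd_Hp_inr_succ, image_closedNbhd_Hp_inl]
    have hrange : c ∘ Sum.inr = fun _ => c (Sum.inr 0) := funext h
    rw [hrange, Set.range_const, h i.succ]

theorem IsIdColoring.add_two_le {p n : ℕ} (hp : 1 ≤ p) {c : Fin p ⊕ Fin (p + 1) → Fin n}
    (hc : IsIdColoring (Hp p) c) : p + 2 ≤ n := by
  obtain ⟨j, hj⟩ := hc.exists_inr_ne hp
  have hpair : Function.Injective ![c (Sum.inr j), c (Sum.inr 0)] := by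
    intro a b hab
    fin_cases a <;> fin_cases b <;> simp_all [eq_comm]
  have hinj : Function.Injective
      (Sum.elim (c ∘ Sum.inl) ![c (Sum.inr j), c (Sum.inr 0)]) := by
    refine hc.inl_injective.sumElim hpair fun i b => ?_
    fin_cases b
    · exact hc.inl_ne_inr i j
    · exact hc.inl_ne_inr i 0
  simpa using Fintype.card_le_of_injective _ hinj

/-- The coloring of `H_p` giving `s_i` its own color, `k_0` a color of its own, and all other
clique vertices one further common color. -/
def HpColoring (p : ℕ) : Fin p ⊕ Fin (p + 1) → Fin (p + 2) :=
  Sum.elim (fun i => i.castSucc.castSucc)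
    (Fin.cases (Fin.last p).castSucc fun _ => Fin.last (p + 1))

theorem range_HpColoring_inr {p : ℕ} (hp : 1 ≤ p) :
    Set.range (HpColoring p ∘ Sum.inr) = {(Fin.last p).castSucc, Fin.last (p + 1)} := by
  have : Nonempty (Fin p) := ⟨⟨0, hp⟩⟩
  ext x
  simp [HpColoring, Fin.exists_fin_succ, eq_comm]

theorem isIdColoring_HpColoring {p : ℕ} (hp : 1 ≤ p) :
    IsIdColoring (Hp p) (HpColoring p) := by
  have hmem (u : Fin p ⊕ Fin (p + 1)) (x : Fin (p + 2)) :
      x ∈ HpColoring p '' closedNbhd (Hp p) u ↔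
        Sum.elim (fun i : Fin p => (x : ℕ) = i ∨ (x : ℕ) = p + 1)
          (fun j : Fin (p + 1) => (x : ℕ) + 1 = j ∨ (x : ℕ) = p ∨ (x : ℕ) = p + 1) u := by
    rcases u with i | j
    · rw [image_closedNbhd_Hp_inl]
      simp [HpColoring, Fin.ext_iff]
    · cases j using Fin.cases with
      | zero =>
        rw [image_closedNbhd_Hp_inr_zero, range_HpColoring_inr hp]
        simp only [Set.mem_insert_iff, Set.mem_singleton_iff, Fin.ext_iff, Fin.val_castSucc,
          Fin.val_last, Sum.elim_inr, Fin.val_zero, Nat.add_one_ne_zero, false_or]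
      | succ i =>
        rw [image_closedNbhd_Hp_inr_succ, range_HpColoring_inr hp]
        simp [HpColoring, Fin.ext_iff]
  intro u v huv h
  have key (x : ℕ) (hx : x < p + 2) := (hmem u ⟨x, hx⟩).symm.trans (h ▸ hmem v ⟨x, hx⟩)
  refine huv (congrArg (closedNbhd (Hp p)) ?_)
  rcases u with i | i <;> rcases v with j | j <;> simp only [Sum.elim_inl, Sum.elim_inr] at key
  · have := key i (by omega)
    exact congrArg Sum.inl (Fin.ext (by omega))
  · have := key p (by omega)
    omega
  · have := key p (by omega)
    omega
  · have hi := key (i - 1) (by omega)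
    have hj := key (j - 1) (by omega)
    exact congrArg Sum.inr (Fin.ext (by omega))

/-- For every integer `p ≥ 1`, `χ_id(H_p) = p + 2`. -/
theorem chiId_Hp (p : ℕ) (hp : 1 ≤ p) : chiId (Hp p) = p + 2 := by
  have hmem : p + 2 ∈ {n | ∃ c : Fin p ⊕ Fin (p + 1) → Fin n, IsIdColoring (Hp p) c} :=
    ⟨HpColoring p, isIdColoring_HpColoring hp⟩
  refine le_antisymm (Nat.sInf_le hmem) (le_csInf ⟨_, hmem⟩ ?_)
  rintro n ⟨c, hc⟩
  exact hc.add_two_le hp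
end

section
/- For every integer p ≥ 1, χ_lid(H_p) = 2p + 1. -/
open SimpleGraph

variable {V : Type*}

/-- `c` is a locally identifying (lid-) coloring of `G`: a proper coloring such
that every pair of adjacent non-twin vertices gets distinct color sets on their
closed neighborhoods. -/
def IsLidColoring {α : Type*} (G : SimpleGraph V) (c : V → α) : Prop :=
  (∀ u v : V, G.Adj u v → c u ≠ c v) ∧
  ∀ u v : V, G.Adj u v → ¬ Twins G u v → c '' closedNbhd G u ≠ c '' closedNbhd G v

/-- `χ_lid(G)`: the minimum number of colors in a lid-coloring of `G`. -/
noncomputable def chiLid (G : SimpleGraph V) : ℕ :=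
  sInf {n | ∃ c : V → Fin n, IsLidColoring G c}

/-- An injective coloring of the vertices is a lid-coloring. -/
theorem isLidColoring_of_injective {α : Type*} {G : SimpleGraph V} {c : V → α}
    (hc : Function.Injective c) : IsLidColoring G c :=
  ⟨fun _ _ h e => h.ne (hc e), fun _ _ _ ht e => ht (hc.image_injective e)⟩

theorem mem_closedNbhd_Hp_inr {p : ℕ} (j : Fin (p + 1)) (x : Fin p ⊕ Fin (p + 1)) :
    x ∈ closedNbhd (Hp p) (Sum.inr j) ↔ ∀ i, x = Sum.inl i → j = i.succ := by
  rcases x with i | k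
  · have hiff : j = i.succ ↔ (j : ℕ) = i + 1 := by simp [Fin.ext_iff]
    simp [closedNbhd, Hp, hiff]
  · simp [closedNbhd, Hp, eq_comm, em]

theorem Hp_adj_inr {p : ℕ} {j k : Fin (p + 1)} (h : j ≠ k) :
    (Hp p).Adj (Sum.inr j) (Sum.inr k) := by
  simp [Hp, h]

/-- The color set of `N[k_j]` consists of the clique colors and the color of the pendant
neighbor of `k_j`, if there is one. -/
theorem image_closedNbhd_Hp_inr {p : ℕ} {α : Type*} (c : Fin p ⊕ Fin (p + 1) → α)
    (j : Fin (p + 1)) :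
    c '' closedNbhd (Hp p) (Sum.inr j) =
      Set.range (c ∘ Sum.inr) ∪ {a | ∃ i : Fin p, j = i.succ ∧ c (Sum.inl i) = a} := by
  ext a
  simp only [Set.mem_image, mem_closedNbhd_Hp_inr, Sum.exists]
  simp [or_comm]

/-- Distinct clique vertices of `H_p` are not twins. -/
theorem not_twins_Hp_inr {p : ℕ} {i : Fin p} {j : Fin (p + 1)} (h : j ≠ i.succ) :
    ¬ Twins (Hp p) (Sum.inr j) (Sum.inr i.succ) := by
  intro ht
  have hmem := Set.ext_iff.mp ht (Sum.inl i)
  simp [mem_closedNbhd_Hp_inr, h] at hmem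

/-- Every lid-coloring of `H_p` gives distinct colors to distinct vertices. -/
theorem IsLidColoring.injective_Hp {p : ℕ} {α : Type*} {c : Fin p ⊕ Fin (p + 1) → α}
    (hc : IsLidColoring (Hp p) c) : Function.Injective c := by
  have hlid (i : Fin p) (j : Fin (p + 1)) (h : j ≠ i.succ) :=
    hc.2 _ _ (Hp_adj_inr h) (not_twins_Hp_inr h)
  simp only [image_closedNbhd_Hp_inr] at hlid
  have hpendant (i : Fin p) (j : Fin (p + 1)) : c (Sum.inl i) ≠ c (Sum.inr j) := by
    intro e
    refine hlid i 0 (Fin.succ_ne_zero i).symm ?_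
    ext a
    simp only [Set.mem_union, Set.mem_range, Set.mem_ofPred_eq, Function.comp_apply,
      Fin.succ_inj]
    grind [Fin.succ_ne_zero]
  rintro (i | j) (i' | j') e
  · by_contra hne
    refine hlid i i'.succ (fun h => hne (by rw [Fin.succ_inj.mp h])) ?_
    simp [e]
  · exact (hpendant i j' e).elim
  · exact (hpendant i' j e.symm).elim
  · by_contra hne
    exact hc.1 _ _ (Hp_adj_inr fun h => hne (by rw [h])) e

/-- For every integer `p ≥ 1`, `χ_lid(H_p) = 2p + 1`. -/
theorem chiLid_Hp (p : ℕ) (hp : 1 ≤ p) : chiLid (Hp p) = 2 * p + 1 := by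
  have hcard : Fintype.card (Fin p ⊕ Fin (p + 1)) = 2 * p + 1 := by
    simp only [Fintype.card_sum, Fintype.card_fin]
    ring
  refine IsLeast.csInf_eq ⟨?_, ?_⟩
  · exact ⟨Fintype.equivFinOfCardEq hcard,
      isLidColoring_of_injective (Equiv.injective _)⟩
  · rintro n ⟨c, hc⟩
    simpa [hcard] using Fintype.card_le_of_injective c hc.injective_Hp
end

section
/- Let p ≥ 1 and let c be any identifying coloring of H_p. Then c(s_i) ≠ c(s_j) for all i ≠ j with 1 ≤ i, j ≤ p, and c(s_i) ≠ c(k_j) for all 1 ≤ i ≤ p and 0 ≤ j ≤ p; moreover the vertices of the clique K_p receive at least two distinct colors under c. -/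
open SimpleGraph

variable {V : Type*}

/-- Any identifying coloring of `H_p` (`p ≥ 1`) gives distinct colors to distinct
`s_i`'s, never gives an `s_i` the color of some `k_j`, and uses at least two
distinct colors on the clique `K_p`. -/
theorem idColoring_Hp_structure {α : Type*} (p : ℕ) (hp : 1 ≤ p)
    (c : Fin p ⊕ Fin (p + 1) → α) (hc : IsIdColoring (Hp p) c) :
    (∀ i j : Fin p, i ≠ j → c (Sum.inl i) ≠ c (Sum.inl j)) ∧
    (∀ (i : Fin p) (j : Fin (p + 1)), c (Sum.inl i) ≠ c (Sum.inr j)) ∧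
    (∃ j j' : Fin (p + 1), c (Sum.inr j) ≠ c (Sum.inr j')) := by
  refine ⟨fun i j hij h => ?_, fun i j h => ?_, ?_⟩
  · refine hc (Sum.inr i.succ) (Sum.inr j.succ) (fun ht => ?_) ?_
    · have hmem : Sum.inl i ∈ closedNbhd (Hp p) (Sum.inr j.succ) := by
        rw [← ht, closedNbhd_Hp_inr_succ]
        exact Set.mem_insert _ _
      simp [closedNbhd_Hp_inr_succ, hij] at hmem
    · rw [closedNbhd_Hp_inr_succ, closedNbhd_Hp_inr_succ, Set.image_insert_eq,
        Set.image_insert_eq, h]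
  · refine hc (Sum.inr i.succ) (Sum.inr 0) (fun ht => ?_) ?_
    · have hmem : Sum.inl i ∈ closedNbhd (Hp p) (Sum.inr 0) := by
        rw [← ht, closedNbhd_Hp_inr_succ]
        exact Set.mem_insert _ _
      simp [closedNbhd_Hp_inr_zero] at hmem
    · rw [closedNbhd_Hp_inr_succ, closedNbhd_Hp_inr_zero, Set.image_insert_eq, h]
      exact Set.insert_eq_of_mem ⟨Sum.inr j, ⟨j, rfl⟩, rfl⟩
  · by_contra! hmono
    let i : Fin p := ⟨0, hp⟩
    refine hc (Sum.inl i) (Sum.inr i.succ) (fun ht => ?_) ?_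
    · have hmem : Sum.inr 0 ∈ closedNbhd (Hp p) (Sum.inl i) := by
        rw [ht, closedNbhd_Hp_inr_succ]
        exact Set.mem_insert_of_mem _ ⟨0, rfl⟩
      simp [closedNbhd_Hp_inl, Fin.ext_iff] at hmem
    · have hclique : c '' Set.range Sum.inr = {c (Sum.inr i.succ)} := by
        rw [← Set.range_comp]
        exact Set.range_eq_singleton_iff.mpr fun j => hmono j i.succ
      rw [closedNbhd_Hp_inl, closedNbhd_Hp_inr_succ, Set.image_pair, Set.image_insert_eq,
        hclique]
end

section
/- For every integer p ≥ 1, the coloring c of H_p defined by c(s_i) = i for i = 1, …, p, c(k_i) = p + 1 for i = 1, …, p, and c(k_0) = p + 2 is an identifying coloring of H_p. -/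
open SimpleGraph

variable {V : Type*}

theorem inl_mem_closedNbhd_Hp_inl {p : ℕ} (i i' : Fin p) :
    Sum.inl i' ∈ closedNbhd (Hp p) (Sum.inl i) ↔ (i' : ℕ) = i := by
  simp [closedNbhd, Hp, Fin.ext_iff]

theorem inr_mem_closedNbhd_Hp_inl {p : ℕ} (i : Fin p) (j : Fin (p + 1)) :
    Sum.inr j ∈ closedNbhd (Hp p) (Sum.inl i) ↔ (j : ℕ) = i + 1 := by
  simp [closedNbhd, Hp]

theorem inl_mem_closedNbhd_Hp_inr {p : ℕ} (j : Fin (p + 1)) (i : Fin p) :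
    Sum.inl i ∈ closedNbhd (Hp p) (Sum.inr j) ↔ (j : ℕ) = i + 1 := by
  simp [closedNbhd, Hp]

theorem inr_mem_closedNbhd_Hp_inr {p : ℕ} (j j' : Fin (p + 1)) :
    Sum.inr j' ∈ closedNbhd (Hp p) (Sum.inr j) := by
  simp only [closedNbhd, Hp, Set.mem_insert_iff, Sum.inr.injEq, mem_neighborSet, fromRel_adj,
    ne_eq, or_self, and_true]
  tauto

/-- The coloring of `Hp p` that gives `s_i` color `i`, the clique vertex `k_0` color `p + 2`, and
every other clique vertex color `p + 1`. -/
def hpColoring (p : ℕ) : Fin p ⊕ Fin (p + 1) → ℕ :=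
  Sum.elim (fun i => (i : ℕ) + 1) (fun j => if (j : ℕ) = 0 then p + 2 else p + 1)

/-- The color of `k_0` is not seen from an independent vertex. -/
theorem color_zero_notMem_image_inl {p : ℕ} (i : Fin p) :
    p + 2 ∉ hpColoring p '' closedNbhd (Hp p) (Sum.inl i) := by
  rintro ⟨i' | j, hmem, hcol⟩
  · simp only [hpColoring, Sum.elim_inl] at hcol
    omega
  · rw [inr_mem_closedNbhd_Hp_inl] at hmem
    simp only [hpColoring, Sum.elim_inr] at hcol
    split_ifs at hcol <;> omega

/-- The color of `k_0` is seen from every clique vertex. -/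
theorem color_zero_mem_image_inr {p : ℕ} (j : Fin (p + 1)) :
    p + 2 ∈ hpColoring p '' closedNbhd (Hp p) (Sum.inr j) :=
  ⟨Sum.inr 0, inr_mem_closedNbhd_Hp_inr j 0, by simp [hpColoring]⟩

/-- An independent vertex sees exactly one color of independent vertices, its own. -/
theorem color_inl_mem_image_inl {p : ℕ} (i m : Fin p) :
    (m : ℕ) + 1 ∈ hpColoring p '' closedNbhd (Hp p) (Sum.inl i) ↔ m = i := by
  constructor
  · rintro ⟨i' | j, hmem, hcol⟩
    · rw [inl_mem_closedNbhd_Hp_inl] at hmem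
      simp only [hpColoring, Sum.elim_inl] at hcol
      omega
    · simp only [hpColoring, Sum.elim_inr] at hcol
      split_ifs at hcol <;> omega
  · rintro rfl
    exact ⟨Sum.inl m, by rw [inl_mem_closedNbhd_Hp_inl], rfl⟩

/-- The only color of independent vertices seen from `k_j` is `j`, if `j` is positive. -/
theorem color_inl_mem_image_inr {p : ℕ} (j : Fin (p + 1)) (m : Fin p) :
    (m : ℕ) + 1 ∈ hpColoring p '' closedNbhd (Hp p) (Sum.inr j) ↔ (j : ℕ) = m + 1 := by
  constructor
  · rintro ⟨i' | j', hmem, hcol⟩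
    · rw [inl_mem_closedNbhd_Hp_inr] at hmem
      simp only [hpColoring, Sum.elim_inl] at hcol
      omega
    · simp only [hpColoring, Sum.elim_inr] at hcol
      split_ifs at hcol <;> omega
  · intro h
    exact ⟨Sum.inl m, by rwa [inl_mem_closedNbhd_Hp_inr], rfl⟩

/-- Distinct vertices of `Hp p` see distinct color sets under `hpColoring p`. -/
theorem image_hpColoring_closedNbhd_injective (p : ℕ) :
    Function.Injective fun u => hpColoring p '' closedNbhd (Hp p) u := by
  rintro (i | j) (i' | j') h <;> dsimp only at h
  · have hi := (color_inl_mem_image_inl i i).2 rfl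
    rw [h, color_inl_mem_image_inl] at hi
    rw [hi]
  · exact absurd (h ▸ color_zero_mem_image_inr j') (color_zero_notMem_image_inl i)
  · exact absurd (h ▸ color_zero_mem_image_inr j) (color_zero_notMem_image_inl i')
  · have key (m : Fin p) : (j : ℕ) = m + 1 ↔ (j' : ℕ) = m + 1 := by
      rw [← color_inl_mem_image_inr, h, color_inl_mem_image_inr]
    congr 1
    induction j using Fin.cases with
    | succ m => exact Fin.ext (((key m).1 rfl).symm)
    | zero =>
      induction j' using Fin.cases with
      | succ m => exact absurd ((key m).2 rfl) (by simp)
      | zero => rfl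

/-- The coloring `c(s_i) = i`, `c(k_i) = p + 1` for `i = 1, …, p`, and
`c(k_0) = p + 2` is an identifying coloring of `H_p`. -/
theorem idColoring_Hp_explicit (p : ℕ) (hp : 1 ≤ p) :
    IsIdColoring (Hp p) (fun v =>
      match v with
      | Sum.inl i => (i : ℕ) + 1
      | Sum.inr j => if (j : ℕ) = 0 then p + 2 else p + 1) := by
  have hid : IsIdColoring (Hp p) (hpColoring p) := fun u v huv h =>
    huv (congrArg (closedNbhd (Hp p)) (image_hpColoring_closedNbhd_injective p h))
  convert hid using 2 with v
  cases v <;> rfl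
end

section
/- For every integer a ≥ 1, χ_lid(H^{ext}_{2^a}) = a + 2^a. -/
open SimpleGraph

variable {V : Type*}

/-- The graph `H^{ext}_{2^a}`: `Sum.inl E` is the clique vertex `k_E` (for
`E ⊆ {1, …, a}`, encoded as `E : Finset (Fin a)`) and `Sum.inr ⟨(E, i), _⟩`
(with `i ∈ E`) is the vertex `s_{E,i}`; besides the clique edges on the `k_E`,
the other edges are `s_{E,i} k_E` for `i ∈ E` and `s_{E,i} s_{E,j}` for
`i, j ∈ E`, `i ≠ j`. -/
def Hext (a : ℕ) :
    SimpleGraph (Finset (Fin a) ⊕ {q : Finset (Fin a) × Fin a // q.2 ∈ q.1}) :=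
  SimpleGraph.fromRel (fun x y =>
    match x, y with
    | Sum.inl _, Sum.inl _ => True
    | Sum.inl E, Sum.inr s => s.1.1 = E
    | Sum.inr s, Sum.inl E => s.1.1 = E
    | Sum.inr s, Sum.inr t => s.1.1 = t.1.1)

theorem IsLidColoring.comp_injective {α β : Type*} {G : SimpleGraph V} {c : V → α}
    (hc : IsLidColoring G c) {f : α → β} (hf : Function.Injective f) :
    IsLidColoring G (f ∘ c) := by
  refine ⟨fun u v h e => hc.1 u v h (hf e), fun u v h ht e => hc.2 u v h ht ?_⟩
  rw [Set.image_comp, Set.image_comp] at e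
  exact hf.image_injective e

namespace Hext

variable {a : ℕ}

theorem inl_mem_closedNbhd_inl (E F : Finset (Fin a)) :
    Sum.inl F ∈ closedNbhd (Hext a) (Sum.inl E) := by
  simp [closedNbhd, Hext]
  tauto

theorem inr_mem_closedNbhd_inl {E : Finset (Fin a)}
    {s : {q : Finset (Fin a) × Fin a // q.2 ∈ q.1}} :
    Sum.inr s ∈ closedNbhd (Hext a) (Sum.inl E) ↔ s.1.1 = E := by
  simp [closedNbhd, Hext]

theorem inl_mem_closedNbhd_inr {E : Finset (Fin a)}
    {s : {q : Finset (Fin a) × Fin a // q.2 ∈ q.1}} :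
    Sum.inl E ∈ closedNbhd (Hext a) (Sum.inr s) ↔ s.1.1 = E := by
  simp [closedNbhd, Hext]

theorem inr_mem_closedNbhd_inr {s t : {q : Finset (Fin a) × Fin a // q.2 ∈ q.1}} :
    Sum.inr t ∈ closedNbhd (Hext a) (Sum.inr s) ↔ s.1.1 = t.1.1 := by
  simp only [closedNbhd, Hext, Set.mem_insert_iff, mem_neighborSet, fromRel_adj, Sum.inr.injEq]
  grind

theorem adj_inl_inl {E F : Finset (Fin a)} :
    (Hext a).Adj (Sum.inl E) (Sum.inl F) ↔ E ≠ F := by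
  simp [Hext]

theorem not_twins_inl {E F : Finset (Fin a)} (h : E ≠ F) :
    ¬ Twins (Hext a) (Sum.inl E) (Sum.inl F) := by
  intro ht
  have key : ∀ (A B : Finset (Fin a)), A ≠ B → A.Nonempty →
      ¬ Twins (Hext a) (Sum.inl A) (Sum.inl B) := by
    rintro A B hAB ⟨i, hi⟩ hT
    have hmem : Sum.inr ⟨(A, i), hi⟩ ∈ closedNbhd (Hext a) (Sum.inl A) :=
      inr_mem_closedNbhd_inl.2 rfl
    rw [hT] at hmem
    exact hAB (inr_mem_closedNbhd_inl.1 hmem)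
  rcases E.eq_empty_or_nonempty with rfl | hE
  · exact key F ∅ h.symm (Finset.nonempty_iff_ne_empty.2 h.symm) ht.symm
  · exact key E F h hE ht

/-- The coloring giving every clique vertex its own color and `s_{E,i}` the color `i`. -/
def coloring (a : ℕ) :
    Finset (Fin a) ⊕ {q : Finset (Fin a) × Fin a // q.2 ∈ q.1} → Fin a ⊕ Finset (Fin a)
  | Sum.inl E => Sum.inr E
  | Sum.inr s => Sum.inl s.1.2

theorem inl_mem_image_coloring {E : Finset (Fin a)} {i : Fin a} :
    Sum.inl i ∈ coloring a '' closedNbhd (Hext a) (Sum.inl E) ↔ i ∈ E := by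
  constructor
  · rintro ⟨F | s, hs, h⟩
    · cases h
    · obtain rfl := inr_mem_closedNbhd_inl.1 hs
      obtain rfl := Sum.inl.inj h
      exact s.2
  · exact fun hi => ⟨Sum.inr ⟨(E, i), hi⟩, inr_mem_closedNbhd_inl.2 rfl, rfl⟩

theorem image_coloring_inl_ne_inr (E : Finset (Fin a))
    (s : {q : Finset (Fin a) × Fin a // q.2 ∈ q.1}) :
    coloring a '' closedNbhd (Hext a) (Sum.inl E) ≠
      coloring a '' closedNbhd (Hext a) (Sum.inr s) := by
  intro h
  have hne : s.1.1 ≠ ∅ := Finset.ne_empty_of_mem s.2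
  have hmem : Sum.inr ∅ ∈ coloring a '' closedNbhd (Hext a) (Sum.inl E) :=
    ⟨Sum.inl ∅, inl_mem_closedNbhd_inl _ _, rfl⟩
  rw [h] at hmem
  obtain ⟨F | t, hF, hc⟩ := hmem
  · obtain rfl := Sum.inr.inj hc
    exact hne (inl_mem_closedNbhd_inr.1 hF)
  · cases hc

theorem isLidColoring_coloring (a : ℕ) : IsLidColoring (Hext a) (coloring a) := by
  constructor
  · rintro (E | s) (F | t) h hc
    · exact adj_inl_inl.1 h (Sum.inr.inj hc)
    · cases hc
    · cases hc
    · have h1 : s.1.1 = t.1.1 := inr_mem_closedNbhd_inr.1 (Set.mem_insert_of_mem _ h)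
      exact h.ne (congrArg Sum.inr (Subtype.ext (Prod.ext h1 (Sum.inl.inj hc))))
  · rintro (E | s) (F | t) h ht hc
    · refine adj_inl_inl.1 h (Finset.ext fun i => ?_)
      rw [← inl_mem_image_coloring, hc, inl_mem_image_coloring]
    · exact image_coloring_inl_ne_inr _ _ hc
    · exact image_coloring_inl_ne_inr _ _ hc.symm
    · have h1 : s.1.1 = t.1.1 := inr_mem_closedNbhd_inr.1 (Set.mem_insert_of_mem _ h)
      refine ht (Set.ext ?_)
      rintro (A | r)
      · rw [inl_mem_closedNbhd_inr, inl_mem_closedNbhd_inr, h1]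
      · rw [inr_mem_closedNbhd_inr, inr_mem_closedNbhd_inr, h1]

theorem le_of_isLidColoring {n : ℕ}
    {c : Finset (Fin a) ⊕ {q : Finset (Fin a) × Fin a // q.2 ∈ q.1} → Fin n}
    (hc : IsLidColoring (Hext a) c) : a + 2 ^ a ≤ n := by
  classical
  have hinj : Function.Injective fun E : Finset (Fin a) => c (Sum.inl E) := by
    intro E F h
    by_contra hne
    exact hc.1 _ _ (adj_inl_inl.2 hne) h
  set R : Finset (Fin n) := Finset.univ.image fun E : Finset (Fin a) => c (Sum.inl E) with hR
  have hRcard : R.card = 2 ^ a := by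
    rw [hR, Finset.card_image_of_injective _ hinj]
    simp
  have hRle : 2 ^ a ≤ n := by
    rw [← hRcard]
    simpa using R.card_le_univ
  have hmem : ∀ E, ∀ x ∈ R, x ∈ c '' closedNbhd (Hext a) (Sum.inl E) := by
    intro E x hx
    obtain ⟨F, -, rfl⟩ := Finset.mem_image.1 hx
    exact Set.mem_image_of_mem _ (inl_mem_closedNbhd_inl E F)
  have hcard : (Finset.univ : Finset (Finset (Fin a))).card ≤ Rᶜ.powerset.card := by
    refine Finset.card_le_card_of_injOn
      (fun E => Rᶜ.filter fun x => x ∈ c '' closedNbhd (Hext a) (Sum.inl E))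
      (fun E _ => Finset.mem_coe.2 (Finset.mem_powerset.2 (Finset.filter_subset _ _))) ?_
    intro E _ F _ h
    by_contra hne
    refine hc.2 _ _ (adj_inl_inl.2 hne) (not_twins_inl hne) (Set.ext fun x => ?_)
    by_cases hx : x ∈ R
    · exact iff_of_true (hmem E x hx) (hmem F x hx)
    · simpa only [Finset.mem_filter, Finset.mem_compl, hx, not_false_eq_true, true_and]
        using Finset.ext_iff.1 h x
  have hpow : 2 ^ a ≤ 2 ^ (n - 2 ^ a) := by
    simpa [Finset.card_powerset, Finset.card_compl, hRcard] using hcard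
  have hle : a ≤ n - 2 ^ a := (Nat.pow_le_pow_iff_right (by norm_num)).1 hpow
  omega

end Hext

/-- For every integer `a ≥ 1`, `χ_lid(H^{ext}_{2^a}) = a + 2^a`. -/
theorem chiLid_Hext (a : ℕ) (ha : 1 ≤ a) : chiLid (Hext a) = a + 2 ^ a := by
  have e : Fin a ⊕ Finset (Fin a) ≃ Fin (a + 2 ^ a) := Fintype.equivFinOfCardEq (by simp)
  have hmem : a + 2 ^ a ∈ {n | ∃ c : _ → Fin n, IsLidColoring (Hext a) c} :=
    ⟨_, (Hext.isLidColoring_coloring a).comp_injective e.injective⟩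
  refine le_antisymm (Nat.sInf_le hmem) (le_csInf ⟨_, hmem⟩ ?_)
  rintro n ⟨c, hc⟩
  exact Hext.le_of_isLidColoring hc
end

section
/- For every integer a ≥ 1, the maximal twin-free induced subgraph H^{ext}_{2^a}\R of H^{ext}_{2^a} is isomorphic to H_{2^a − 1}. -/
open SimpleGraph

variable {V : Type*}

theorem mem_closedNbhd {G : SimpleGraph V} {u v : V} :
    v ∈ closedNbhd G u ↔ v = u ∨ G.Adj u v := by
  simp [closedNbhd]

/-- If `G` arises from a twin-free graph `H` by blowing up each vertex `x` of `H` into the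
nonempty clique `c ⁻¹' {x}`, then `G` induces a copy of `H` on every set of representatives of
its twin classes. -/
theorem IsRepSet.nonempty_induce_iso {W : Type*} {G : SimpleGraph V} {H : SimpleGraph W}
    {c : V → W} (hc : Function.Surjective c)
    (hadj : ∀ u v, G.Adj u v ↔ u ≠ v ∧ (c u = c v ∨ H.Adj (c u) (c v)))
    (hH : ∀ x y, Twins H x y → x = y) {s : Finset V} (hs : IsRepSet G s) :
    Nonempty (G.induce (↑s : Set V) ≃g H) := by
  have mem_iff (u w : V) : w ∈ closedNbhd G u ↔ c w ∈ closedNbhd H (c u) := by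
    rw [mem_closedNbhd, mem_closedNbhd, hadj]
    grind
  have twins_iff (u v : V) : Twins G u v ↔ c u = c v := by
    refine ⟨fun h => hH _ _ (Set.ext fun x => ?_), fun h => Set.ext fun w => ?_⟩
    · obtain ⟨w, rfl⟩ := hc x
      rw [← mem_iff, ← mem_iff, h]
    · rw [mem_iff, mem_iff, h]
  have hinj : Function.Injective fun v : (↑s : Set V) => c v := fun u v h =>
    Subtype.ext <| (hs u).unique ⟨u.2, rfl⟩ ⟨v.2, (twins_iff _ _).2 h⟩
  have hsurj : Function.Surjective fun v : (↑s : Set V) => c v := fun x => by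
    obtain ⟨v, rfl⟩ := hc x
    obtain ⟨w, ⟨hw, hvw⟩, -⟩ := hs v
    exact ⟨⟨w, hw⟩, ((twins_iff _ _).1 hvw).symm⟩
  refine ⟨⟨Equiv.ofBijective _ ⟨hinj, hsurj⟩, fun {u v} => ?_⟩⟩
  change H.Adj (c u) (c v) ↔ G.Adj u v
  rw [hadj]
  refine ⟨fun h => ⟨fun huv => h.ne (congrArg c huv), Or.inr h⟩, fun ⟨hne, h⟩ => ?_⟩
  exact h.resolve_left fun h => hne (congrArg Subtype.val (hinj h))

theorem Hp_eq_of_twins {p : ℕ} (x y : Fin p ⊕ Fin (p + 1)) (h : Twins (Hp p) x y) : x = y := by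
  have hmem (z) : z ∈ closedNbhd (Hp p) x ↔ z ∈ closedNbhd (Hp p) y := by rw [h]
  simp only [mem_closedNbhd, Hp, fromRel_adj] at hmem
  rcases x with i | j <;> rcases y with k | l
  · simpa using hmem (.inl i)
  · have := hmem (.inr 0)
    simp at this
    grind
  · have := hmem (.inr 0)
    simp at this
    grind
  · induction j using Fin.cases with
    | zero =>
      induction l using Fin.cases with
      | zero => rfl
      | succ l => simpa using hmem (.inl l)
    | succ j =>
      have := hmem (.inl j)
      simp at this
      simp [Fin.ext_iff, this]

/-- The map sending `k_E` to `k_j` and every `s_{E,i}` to `s_j`, where `j = e E`. -/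
def HextToHp {a p : ℕ} (e : Finset (Fin a) ≃ Fin (p + 1)) (he : e ∅ = 0) :
    Finset (Fin a) ⊕ {q : Finset (Fin a) × Fin a // q.2 ∈ q.1} → Fin p ⊕ Fin (p + 1)
  | .inl E => .inr (e E)
  | .inr q => .inl ((e q.1.1).pred
      (he ▸ e.injective.ne (Finset.ne_empty_of_mem q.2)))

theorem HextToHp_surjective {a p : ℕ} (e : Finset (Fin a) ≃ Fin (p + 1)) (he : e ∅ = 0) :
    Function.Surjective (HextToHp e he) := by
  rintro (i | j)
  · have hne : (e.symm i.succ).Nonempty := by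
      rw [Finset.nonempty_iff_ne_empty, Ne, Equiv.symm_apply_eq, he]
      exact i.succ_ne_zero
    obtain ⟨k, hk⟩ := hne
    exact ⟨.inr ⟨(e.symm i.succ, k), hk⟩, by simp [HextToHp]⟩
  · exact ⟨.inl (e.symm j), by simp [HextToHp]⟩

theorem Hext_adj_iff {a p : ℕ} (e : Finset (Fin a) ≃ Fin (p + 1)) (he : e ∅ = 0)
    (u v : Finset (Fin a) ⊕ {q : Finset (Fin a) × Fin a // q.2 ∈ q.1}) :
    (Hext a).Adj u v ↔ u ≠ v ∧
      (HextToHp e he u = HextToHp e he v ∨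
        (Hp p).Adj (HextToHp e he u) (HextToHp e he v)) := by
  have val_pred (j : Fin (p + 1)) (hj : j ≠ 0) : ((j.pred hj : Fin p) : ℕ) + 1 = j := by
    rw [← Fin.val_succ, Fin.succ_pred]
  rcases u with E | q <;> rcases v with F | r
  · simp [Hext, Hp, HextToHp, em]
  · simp [Hext, Hp, HextToHp, val_pred, Fin.val_inj, eq_comm, -Fin.val_pred]
  · simp [Hext, Hp, HextToHp, val_pred, Fin.val_inj, eq_comm, -Fin.val_pred]
  · simp [Hext, Hp, HextToHp, Fin.pred_inj, eq_comm]

theorem exists_equiv_fin_apply_empty (a : ℕ) :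
    ∃ e : Finset (Fin a) ≃ Fin (2 ^ a - 1 + 1), e ∅ = 0 := by
  have hcard : Fintype.card (Finset (Fin a)) = 2 ^ a - 1 + 1 := by
    rw [Fintype.card_finset, Fintype.card_fin, Nat.sub_add_cancel Nat.one_le_two_pow]
  let f := Fintype.equivFinOfCardEq hcard
  exact ⟨f.trans (Equiv.swap (f ∅) 0), by simp⟩

/-- For every integer `a ≥ 1`, the maximal twin-free induced subgraph
`H^{ext}_{2^a}\R` of `H^{ext}_{2^a}` is isomorphic to `H_{2^a - 1}`. -/
theorem Hext_quotient_iso_Hp (a : ℕ) (ha : 1 ≤ a)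
    (s : Finset (Finset (Fin a) ⊕ {q : Finset (Fin a) × Fin a // q.2 ∈ q.1}))
    (hs : IsRepSet (Hext a) s) :
    Nonempty ((Hext a).induce
        (↑s : Set (Finset (Fin a) ⊕ {q : Finset (Fin a) × Fin a // q.2 ∈ q.1}))
      ≃g Hp (2 ^ a - 1)) := by
  obtain ⟨e, he⟩ := exists_equiv_fin_apply_empty a
  exact hs.nonempty_induce_iso (HextToHp_surjective e he) (Hext_adj_iff e he) Hp_eq_of_twins
end

section
/- For every integer a ≥ 1, t(H^{ext}_{2^a}) = 2^a − 1 − a and T(H^{ext}_{2^a}) = a, i.e., in H^{ext}_{2^a} the number of twin-equivalence classes with at least two vertices is 2^a − 1 − a and the largest twin-equivalence class has exactly a vertices. -/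
open SimpleGraph

variable {V : Type*}

open Classical in
/-- The twin-equivalence class of a vertex, as a `Finset`. -/
noncomputable def twinClass (G : SimpleGraph V) [Fintype V] (v : V) : Finset V :=
  Finset.univ.filter (Twins G v)

open Classical in
/-- `t(G)`: the number of twin-equivalence classes with at least two vertices. -/
noncomputable def numBigTwinClasses (G : SimpleGraph V) [Fintype V] : ℕ :=
  ((Finset.univ.image (twinClass G)).filter (fun Q => 2 ≤ Q.card)).card

/-- `T(G)`: the cardinality of a largest twin-equivalence class. -/
noncomputable def maxTwinClass (G : SimpleGraph V) [Fintype V] : ℕ :=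
  Finset.univ.sup (fun v => (twinClass G v).card)

/-- Every clique vertex lies in the closed neighborhood of every other one. -/
theorem mem_closedNbhd_Hext_inl_inl {a : ℕ} (E F : Finset (Fin a)) :
    Sum.inl F ∈ closedNbhd (Hext a) (Sum.inl E) := by
  by_cases h : F = E
  · simp [closedNbhd, h]
  · simp [closedNbhd, Hext, Ne.symm h]

theorem mem_closedNbhd_Hext_inl_inr {a : ℕ} (E : Finset (Fin a))
    (s : {q : Finset (Fin a) × Fin a // q.2 ∈ q.1}) :
    Sum.inr s ∈ closedNbhd (Hext a) (Sum.inl E) ↔ s.1.1 = E := by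
  simp [closedNbhd, Hext]

theorem mem_closedNbhd_Hext_inr_inl {a : ℕ} (E : Finset (Fin a))
    (s : {q : Finset (Fin a) × Fin a // q.2 ∈ q.1}) :
    Sum.inl E ∈ closedNbhd (Hext a) (Sum.inr s) ↔ s.1.1 = E := by
  simp [closedNbhd, Hext]

theorem mem_closedNbhd_Hext_inr_inr {a : ℕ}
    (s t : {q : Finset (Fin a) × Fin a // q.2 ∈ q.1}) :
    Sum.inr t ∈ closedNbhd (Hext a) (Sum.inr s) ↔ s.1.1 = t.1.1 := by
  by_cases h : t = s
  · simp [closedNbhd, h]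
  · simp [closedNbhd, Hext, Ne.symm h, eq_comm]

theorem twins_Hext_inl_inl {a : ℕ} (E F : Finset (Fin a)) :
    Twins (Hext a) (Sum.inl E) (Sum.inl F) ↔ E = F := by
  refine ⟨fun h => ?_, fun h => h ▸ rfl⟩
  have key (i : Fin a) (A : Finset (Fin a)) (hi : i ∈ A) : A = E ↔ A = F := by
    rw [← mem_closedNbhd_Hext_inl_inr E ⟨(A, i), hi⟩,
      ← mem_closedNbhd_Hext_inl_inr F ⟨(A, i), hi⟩, show closedNbhd _ _ = _ from h]
  rcases E.eq_empty_or_nonempty with rfl | ⟨i, hi⟩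
  · rcases F.eq_empty_or_nonempty with rfl | ⟨i, hi⟩
    · rfl
    · exact ((key i F hi).2 rfl).symm
  · exact (key i E hi).1 rfl

theorem not_twins_Hext_inl_inr {a : ℕ} (E : Finset (Fin a))
    (s : {q : Finset (Fin a) × Fin a // q.2 ∈ q.1}) :
    ¬ Twins (Hext a) (Sum.inl E) (Sum.inr s) := by
  intro h
  have hmem := mem_closedNbhd_Hext_inl_inl E ∅
  rw [show closedNbhd _ _ = _ from h, mem_closedNbhd_Hext_inr_inl] at hmem
  exact Finset.ne_empty_of_mem s.2 hmem

theorem twins_Hext_inr_inr {a : ℕ} (s t : {q : Finset (Fin a) × Fin a // q.2 ∈ q.1}) :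
    Twins (Hext a) (Sum.inr s) (Sum.inr t) ↔ s.1.1 = t.1.1 := by
  constructor
  · intro h
    have hmem := (mem_closedNbhd_Hext_inr_inr t t).2 rfl
    rwa [← show closedNbhd _ _ = _ from h, mem_closedNbhd_Hext_inr_inr] at hmem
  · intro h
    ext (F | u)
    · rw [mem_closedNbhd_Hext_inr_inl, mem_closedNbhd_Hext_inr_inl, h]
    · rw [mem_closedNbhd_Hext_inr_inr, mem_closedNbhd_Hext_inr_inr, h]

/-- The set of vertices `s_{E,i}` with `i ∈ E`. -/
def pendantClique {a : ℕ} (E : Finset (Fin a)) :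
    Finset (Finset (Fin a) ⊕ {q : Finset (Fin a) × Fin a // q.2 ∈ q.1}) :=
  E.attach.map ⟨fun i => Sum.inr ⟨(E, i.1), i.2⟩, fun _ _ h =>
    Subtype.ext (congrArg (fun s => s.1.2) (Sum.inr.inj h))⟩

theorem card_pendantClique {a : ℕ} (E : Finset (Fin a)) : (pendantClique E).card = E.card := by
  simp [pendantClique]

theorem inl_notMem_pendantClique {a : ℕ} (E F : Finset (Fin a)) :
    Sum.inl F ∉ pendantClique E := by
  simp [pendantClique]

theorem inr_mem_pendantClique {a : ℕ} (E : Finset (Fin a))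
    (s : {q : Finset (Fin a) × Fin a // q.2 ∈ q.1}) :
    Sum.inr s ∈ pendantClique E ↔ s.1.1 = E := by
  obtain ⟨⟨F, i⟩, hi⟩ := s
  simp only [pendantClique, Finset.mem_map, Finset.mem_attach, true_and]
  constructor
  · rintro ⟨_, h⟩
    exact (congrArg (fun s => s.1.1) (Sum.inr.inj h)).symm
  · rintro rfl
    exact ⟨⟨i, hi⟩, rfl⟩

theorem pendantClique_injOn {a : ℕ} :
    Set.InjOn (pendantClique (a := a)) {E | 2 ≤ E.card} := by
  intro E hE F _ h
  obtain ⟨i, hi⟩ : E.Nonempty := Finset.card_pos.1 (by simp at hE; omega)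
  have hmem := (inr_mem_pendantClique E ⟨(E, i), hi⟩).2 rfl
  rwa [h, inr_mem_pendantClique] at hmem

theorem twinClass_Hext_inl {a : ℕ} (E : Finset (Fin a)) :
    twinClass (Hext a) (Sum.inl E) = {Sum.inl E} := by
  ext (F | s)
  · simp [twinClass, twins_Hext_inl_inl, eq_comm]
  · simp [twinClass, not_twins_Hext_inl_inr]

theorem twinClass_Hext_inr {a : ℕ} (s : {q : Finset (Fin a) × Fin a // q.2 ∈ q.1}) :
    twinClass (Hext a) (Sum.inr s) = pendantClique s.1.1 := by
  ext (F | t)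
  · simpa [twinClass, inl_notMem_pendantClique] using
      fun h : Twins _ _ _ => not_twins_Hext_inl_inr F s h.symm
  · simp only [twinClass, Finset.mem_filter, Finset.mem_univ, true_and, twins_Hext_inr_inr,
      inr_mem_pendantClique, eq_comm]

theorem card_filter_two_le_card (α : Type*) [Fintype α] [DecidableEq α] :
    (Finset.univ.filter fun E : Finset α => 2 ≤ E.card).card
      = 2 ^ Fintype.card α - 1 - Fintype.card α := by
  have hsplit := Finset.card_filter_add_card_filter_not (s := (Finset.univ : Finset (Finset α)))
    (fun E => 2 ≤ E.card)
  have hsmall : (Finset.univ.filter fun E : Finset α => ¬ 2 ≤ E.card)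
      = Finset.powersetCard 0 Finset.univ ∪ Finset.powersetCard 1 Finset.univ := by
    ext E
    simp only [Finset.mem_filter, Finset.mem_univ, true_and, Finset.mem_union,
      Finset.mem_powersetCard, Finset.subset_univ]
    omega
  have hdisj : Disjoint (Finset.powersetCard 0 (Finset.univ : Finset α))
      (Finset.powersetCard 1 Finset.univ) :=
    Finset.pairwise_disjoint_powersetCard _ (by decide)
  rw [hsmall, Finset.card_union_of_disjoint hdisj, Finset.card_powersetCard,
    Finset.card_powersetCard, Finset.card_univ, Finset.card_univ, Fintype.card_finset,
    Nat.choose_zero_right, Nat.choose_one_right] at hsplit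
  omega

theorem numBigTwinClasses_Hext (a : ℕ) : numBigTwinClasses (Hext a) = 2 ^ a - 1 - a := by
  classical
  have himage : (Finset.univ.image (twinClass (Hext a))).filter (fun Q => 2 ≤ Q.card)
      = (Finset.univ.filter fun E : Finset (Fin a) => 2 ≤ E.card).image pendantClique := by
    ext Q
    simp only [Finset.mem_filter, Finset.mem_image, Finset.mem_univ, true_and]
    constructor
    · rintro ⟨⟨E | s, rfl⟩, hQ⟩
      · simp [twinClass_Hext_inl] at hQ
      · rw [twinClass_Hext_inr, card_pendantClique] at hQ
        exact ⟨_, hQ, (twinClass_Hext_inr s).symm⟩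
    · rintro ⟨E, hE, rfl⟩
      obtain ⟨i, hi⟩ : E.Nonempty := Finset.card_pos.1 (by omega)
      exact ⟨⟨Sum.inr ⟨(E, i), hi⟩, twinClass_Hext_inr _⟩, by rwa [card_pendantClique]⟩
  have hcard := card_filter_two_le_card (Fin a)
  rw [Fintype.card_fin] at hcard
  rw [← hcard, ← Finset.card_image_of_injOn (f := pendantClique)
    (pendantClique_injOn.mono (by simp)), ← himage, numBigTwinClasses]
  congr!

theorem maxTwinClass_Hext (a : ℕ) (ha : 1 ≤ a) : maxTwinClass (Hext a) = a := by
  apply le_antisymm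
  · refine Finset.sup_le ?_
    rintro (E | s) -
    · simpa [twinClass_Hext_inl] using ha
    · rw [twinClass_Hext_inr, card_pendantClique]
      exact card_finset_fin_le _
  · have h := Finset.le_sup (f := fun v => (twinClass (Hext a) v).card)
      (Finset.mem_univ (Sum.inr ⟨(Finset.univ, ⟨0, ha⟩), Finset.mem_univ _⟩))
    simpa [maxTwinClass, twinClass_Hext_inr, card_pendantClique] using h

/-- For every integer `a ≥ 1`, `t(H^{ext}_{2^a}) = 2^a - 1 - a` and
`T(H^{ext}_{2^a}) = a`. -/
theorem Hext_twin_params (a : ℕ) (ha : 1 ≤ a) :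
    numBigTwinClasses (Hext a) = 2 ^ a - 1 - a ∧ maxTwinClass (Hext a) = a := by
  exact ⟨numBigTwinClasses_Hext a, maxTwinClass_Hext a ha⟩
end

section
/- For all integers p ≥ t ≥ 1 and T ≥ 1, χ_lid(H_p^{(T,t)}) = 2p + 1 + (T − 1)·t. -/
open SimpleGraph

variable {V : Type*}

/-- Projection sending each added twin copy `(i, m)` to the clique vertex
`k_{i+1}` of `H_p` that it duplicates, and fixing the vertices of `H_p`. -/
def twinProj (p t T : ℕ) (htp : t ≤ p) :
    (Fin p ⊕ Fin (p + 1) ⊕ Fin t × Fin (T - 1)) → (Fin p ⊕ Fin (p + 1))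
  | Sum.inl i => Sum.inl i
  | Sum.inr (Sum.inl j) => Sum.inr j
  | Sum.inr (Sum.inr (i, _)) => Sum.inr (Fin.castLE htp i).succ

/-- `H_p^{(T,t)}`: the graph obtained from `H_p` by adding `T - 1` new vertices
that are closed-neighborhood twins of `k_i`, for each `i = 1, …, t`. Two
vertices are adjacent iff their projections to `H_p` are adjacent, or they are
distinct vertices with equal projections. -/
def HpTt (p t T : ℕ) (htp : t ≤ p) :
    SimpleGraph (Fin p ⊕ Fin (p + 1) ⊕ Fin t × Fin (T - 1)) :=
  SimpleGraph.fromRel (fun x y =>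
    (Hp p).Adj (twinProj p t T htp x) (twinProj p t T htp y) ∨
      twinProj p t T htp x = twinProj p t T htp y)

/-- An injective coloring is a lid-coloring of every graph. -/
lemma IsLidColoring.of_injective {α : Type*} (G : SimpleGraph V) {c : V → α}
    (hc : Function.Injective c) : IsLidColoring G c :=
  ⟨fun _ _ h => hc.ne h.ne, fun _ _ _ hT h => hT (hc.image_injective h)⟩

/-- If all lid-colorings of a finite graph are injective, then `χ_lid` is its order. -/
lemma chiLid_eq_card_of_forall_injective [Fintype V] (G : SimpleGraph V)
    (h : ∀ (n : ℕ) (c : V → Fin n), IsLidColoring G c → Function.Injective c) :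
    chiLid G = Fintype.card V := by
  apply le_antisymm
  · exact Nat.sInf_le ⟨Fintype.equivFin V, .of_injective G (Fintype.equivFin V).injective⟩
  · refine le_csInf ⟨_, Fintype.equivFin V, .of_injective G (Fintype.equivFin V).injective⟩ ?_
    rintro n ⟨c, hc⟩
    simpa using Fintype.card_le_of_injective c (h n c hc)

namespace HpTt

variable {p t T : ℕ} {htp : t ≤ p}

lemma adj_inr_inr (x y : Fin (p + 1) ⊕ Fin t × Fin (T - 1)) :
    (HpTt p t T htp).Adj (Sum.inr x) (Sum.inr y) ↔ x ≠ y := by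
  rcases x with x | ⟨x, m⟩ <;> rcases y with y | ⟨y, n⟩ <;>
    simp [HpTt, Hp, twinProj] <;> grind

lemma adj_clique_inl (j : Fin (p + 1)) (i : Fin p) :
    (HpTt p t T htp).Adj (Sum.inr (Sum.inl j)) (Sum.inl i) ↔ j = i.succ := by
  simp [HpTt, Hp, twinProj, Fin.ext_iff]

lemma mem_closedNbhd_clique_inl (j : Fin (p + 1)) (i : Fin p) :
    Sum.inl i ∈ closedNbhd (HpTt p t T htp) (Sum.inr (Sum.inl j)) ↔ j = i.succ := by
  simp [closedNbhd, adj_clique_inl]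

lemma mem_closedNbhd_clique_inr (j : Fin (p + 1)) (y : Fin (p + 1) ⊕ Fin t × Fin (T - 1)) :
    Sum.inr y ∈ closedNbhd (HpTt p t T htp) (Sum.inr (Sum.inl j)) := by
  by_cases h : y = Sum.inl j
  · simp [closedNbhd, h]
  · simp [closedNbhd, adj_inr_inr, Ne.symm h]

lemma image_closedNbhd_zero {α : Type*}
    (c : (Fin p ⊕ Fin (p + 1) ⊕ Fin t × Fin (T - 1)) → α) :
    c '' closedNbhd (HpTt p t T htp) (Sum.inr (Sum.inl 0)) =
      Set.range fun y => c (Sum.inr y) := by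
  ext a
  rw [Set.mem_image, Sum.exists]
  simp only [mem_closedNbhd_clique_inl, mem_closedNbhd_clique_inr, (Fin.succ_ne_zero _).symm,
    false_and, exists_false, false_or, true_and, Set.mem_range]

lemma image_closedNbhd_succ {α : Type*}
    (c : (Fin p ⊕ Fin (p + 1) ⊕ Fin t × Fin (T - 1)) → α) (i : Fin p) :
    c '' closedNbhd (HpTt p t T htp) (Sum.inr (Sum.inl i.succ)) =
      insert (c (Sum.inl i)) (Set.range fun y => c (Sum.inr y)) := by
  ext a
  rw [Set.mem_image, Sum.exists]
  simp only [mem_closedNbhd_clique_inl, mem_closedNbhd_clique_inr, Fin.succ_inj, true_and,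
    exists_eq_left', Set.mem_insert_iff, Set.mem_range, eq_comm (a := a)]

lemma not_twins_clique_succ {j : Fin (p + 1)} {i : Fin p} (h : j ≠ i.succ) :
    ¬ Twins (HpTt p t T htp) (Sum.inr (Sum.inl j)) (Sum.inr (Sum.inl i.succ)) := by
  intro hT
  have hmem := (mem_closedNbhd_clique_inl (t := t) (T := T) (htp := htp) i.succ i).2 rfl
  rw [← hT] at hmem
  exact h ((mem_closedNbhd_clique_inl j i).1 hmem)

/-- Every lid-coloring of `H_p^{(T,t)}` is injective. -/
lemma injective_of_isLidColoring {α : Type*}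
    {c : (Fin p ⊕ Fin (p + 1) ⊕ Fin t × Fin (T - 1)) → α}
    (hc : IsLidColoring (HpTt p t T htp) c) : Function.Injective c := by
  have hne {j : Fin (p + 1)} {i : Fin p} (h : j ≠ i.succ) :=
    hc.2 _ _ ((adj_inr_inr (Sum.inl j) (Sum.inl i.succ)).2 (by simpa using h))
      (not_twins_clique_succ h)
  have hout (i : Fin p) (y) : c (Sum.inl i) ≠ c (Sum.inr y) := by
    intro h
    apply hne (Fin.succ_ne_zero i).symm
    rw [image_closedNbhd_zero, image_closedNbhd_succ, h]
    exact (Set.insert_eq_of_mem (Set.mem_range_self y)).symm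
  rintro (i | x) (j | y) h
  · by_contra hij
    apply hne (j := i.succ) (i := j) (by simpa using hij)
    rw [image_closedNbhd_succ, image_closedNbhd_succ, h]
  · exact absurd h (hout i y)
  · exact absurd h.symm (hout j x)
  · by_contra hxy
    exact hc.1 _ _ ((adj_inr_inr x y).2 (by simpa using hxy)) h

end HpTt

/-- For all integers `p ≥ t ≥ 1` and `T ≥ 1`,
`χ_lid(H_p^{(T,t)}) = 2p + 1 + (T - 1) · t`. -/
theorem chiLid_HpTt (p t T : ℕ) (ht : 1 ≤ t) (htp : t ≤ p) (hT : 1 ≤ T) :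
    chiLid (HpTt p t T htp) = 2 * p + 1 + (T - 1) * t := by
  rw [chiLid_eq_card_of_forall_injective _ fun _ _ => HpTt.injective_of_isLidColoring]
  simp only [Fintype.card_sum, Fintype.card_prod, Fintype.card_fin]
  ring
end

section
/- For all integers p ≥ t ≥ 1 and T ≥ 2, the maximal twin-free induced subgraph H_p^{(T,t)}\R of H_p^{(T,t)} is isomorphic to H_p, and moreover t(H_p^{(T,t)}) = t and T(H_p^{(T,t)}) = T. -/
open SimpleGraph

variable {V : Type*}

theorem Hp_adj_inl_inr {p : ℕ} {i : Fin p} {j : Fin (p + 1)} :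
    (Hp p).Adj (Sum.inl i) (Sum.inr j) ↔ j = i.succ := by
  simp [Hp, Fin.ext_iff]

theorem Hp_adj_inr_inl {p : ℕ} {i : Fin p} {j : Fin (p + 1)} :
    (Hp p).Adj (Sum.inr j) (Sum.inl i) ↔ j = i.succ := by
  rw [SimpleGraph.adj_comm, Hp_adj_inl_inr]

theorem Hp_adj_inr_inr {p : ℕ} {i j : Fin (p + 1)} :
    (Hp p).Adj (Sum.inr i) (Sum.inr j) ↔ i ≠ j := by
  simp [Hp]

theorem Hp_not_adj_inl_inl {p : ℕ} {i j : Fin p} :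
    ¬ (Hp p).Adj (Sum.inl i) (Sum.inl j) := by
  simp [Hp]

theorem Hp_not_twins_inl_inr {p : ℕ} (i : Fin p) (j : Fin (p + 1)) :
    ¬ Twins (Hp p) (Sum.inl i) (Sum.inr j) := by
  intro h
  have h0 : Sum.inr 0 ∈ closedNbhd (Hp p) (Sum.inl i) := by
    rw [h, mem_closedNbhd, Hp_adj_inr_inr, Sum.inr.injEq]
    tauto
  rw [mem_closedNbhd, Hp_adj_inl_inr] at h0
  exact h0.elim Sum.inr_ne_inl (Fin.succ_ne_zero i).symm

/-- The graph `H_p` is twin-free. -/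
theorem Hp_twins_iff {p : ℕ} {a b : Fin p ⊕ Fin (p + 1)} :
    Twins (Hp p) a b ↔ a = b := by
  refine ⟨fun h => ?_, fun h => h ▸ rfl⟩
  rcases a with i | i <;> rcases b with j | j
  · have hi : Sum.inl i ∈ closedNbhd (Hp p) (Sum.inl j) := by
      rw [← h, mem_closedNbhd]
      exact Or.inl rfl
    rw [mem_closedNbhd] at hi
    exact hi.resolve_right Hp_not_adj_inl_inl
  · exact (Hp_not_twins_inl_inr i j h).elim
  · exact (Hp_not_twins_inl_inr j i h.symm).elim
  · have key (k : Fin p) : i = k.succ ↔ j = k.succ := by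
      have hk := Set.ext_iff.mp h (Sum.inl k)
      simpa [mem_closedNbhd, Hp_adj_inr_inl] using hk
    refine congrArg Sum.inr ?_
    induction i using Fin.cases with
    | succ i => exact ((key i).mp rfl).symm
    | zero =>
      induction j using Fin.cases with
      | succ j => exact (key j).mpr rfl
      | zero => rfl

theorem twinProj_surjective {p t T : ℕ} (htp : t ≤ p) :
    Function.Surjective (twinProj p t T htp) := by
  rintro (i | j)
  · exact ⟨Sum.inl i, rfl⟩
  · exact ⟨Sum.inr (Sum.inl j), rfl⟩

theorem HpTt_adj {p t T : ℕ} {htp : t ≤ p} {x y : Fin p ⊕ Fin (p + 1) ⊕ Fin t × Fin (T - 1)} :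
    (HpTt p t T htp).Adj x y ↔
      x ≠ y ∧ ((Hp p).Adj (twinProj p t T htp x) (twinProj p t T htp y) ∨
        twinProj p t T htp x = twinProj p t T htp y) := by
  rw [HpTt, SimpleGraph.fromRel_adj, SimpleGraph.adj_comm _ (twinProj p t T htp y),
    eq_comm (a := twinProj p t T htp y), or_self]

theorem closedNbhd_HpTt {p t T : ℕ} {htp : t ≤ p}
    (x : Fin p ⊕ Fin (p + 1) ⊕ Fin t × Fin (T - 1)) :
    closedNbhd (HpTt p t T htp) x =
      twinProj p t T htp ⁻¹' closedNbhd (Hp p) (twinProj p t T htp x) := by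
  ext y
  rw [Set.mem_preimage, mem_closedNbhd, mem_closedNbhd, HpTt_adj]
  by_cases h : y = x
  · simp [h]
  · simp only [h, false_or, ne_eq, Ne.symm h, not_false_eq_true, true_and]
    rw [or_comm, eq_comm]

theorem HpTt_twins_iff {p t T : ℕ} {htp : t ≤ p}
    {x y : Fin p ⊕ Fin (p + 1) ⊕ Fin t × Fin (T - 1)} :
    Twins (HpTt p t T htp) x y ↔ twinProj p t T htp x = twinProj p t T htp y := by
  rw [Twins, closedNbhd_HpTt, closedNbhd_HpTt,
    (twinProj_surjective htp).preimage_injective.eq_iff]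
  exact Hp_twins_iff

theorem nonempty_induce_HpTt_iso_Hp {p t T : ℕ} {htp : t ≤ p}
    {s : Finset (Fin p ⊕ Fin (p + 1) ⊕ Fin t × Fin (T - 1))}
    (hs : IsRepSet (HpTt p t T htp) s) :
    Nonempty ((HpTt p t T htp).induce
        (↑s : Set (Fin p ⊕ Fin (p + 1) ⊕ Fin t × Fin (T - 1))) ≃g Hp p) := by
  let f : (↑s : Set (Fin p ⊕ Fin (p + 1) ⊕ Fin t × Fin (T - 1))) → Fin p ⊕ Fin (p + 1) :=
    fun x => twinProj p t T htp x
  have hinj : Function.Injective f := fun x y hxy =>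
    Subtype.ext ((hs x).unique ⟨x.2, rfl⟩ ⟨y.2, HpTt_twins_iff.mpr hxy⟩)
  have hsurj : Function.Surjective f := fun a => by
    obtain ⟨v, rfl⟩ := twinProj_surjective (T := T) htp a
    obtain ⟨w, ⟨hw, hvw⟩, -⟩ := hs v
    exact ⟨⟨w, hw⟩, (HpTt_twins_iff.mp hvw).symm⟩
  refine ⟨⟨Equiv.ofBijective f ⟨hinj, hsurj⟩, fun {x y} => ?_⟩⟩
  change (Hp p).Adj (f x) (f y) ↔ (HpTt p t T htp).Adj x y
  rw [HpTt_adj]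
  refine ⟨fun h => ⟨fun hxy => h.ne (congrArg f (Subtype.ext hxy)), Or.inl h⟩, ?_⟩
  rintro ⟨hne, h | h⟩
  · exact h
  · exact (hne (congrArg Subtype.val (hinj h))).elim

theorem mem_twinClass_HpTt {p t T : ℕ} {htp : t ≤ p}
    {x y : Fin p ⊕ Fin (p + 1) ⊕ Fin t × Fin (T - 1)} :
    y ∈ twinClass (HpTt p t T htp) x ↔ twinProj p t T htp x = twinProj p t T htp y := by
  simp [twinClass, HpTt_twins_iff]

theorem twinClass_HpTt_eq_iff {p t T : ℕ} {htp : t ≤ p}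
    {x y : Fin p ⊕ Fin (p + 1) ⊕ Fin t × Fin (T - 1)} :
    twinClass (HpTt p t T htp) x = twinClass (HpTt p t T htp) y ↔
      twinProj p t T htp x = twinProj p t T htp y := by
  refine ⟨fun h => ?_, fun h => ?_⟩
  · rw [← mem_twinClass_HpTt, h, mem_twinClass_HpTt]
  · ext z
    rw [mem_twinClass_HpTt, mem_twinClass_HpTt, h]

/-- The twin class of a duplicated clique vertex has `T` elements. -/
theorem card_twinClass_HpTt_of_duplicated {p t T : ℕ} {htp : t ≤ p} (hT : 1 ≤ T)
    {x : Fin p ⊕ Fin (p + 1) ⊕ Fin t × Fin (T - 1)} {i : Fin t}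
    (hx : twinProj p t T htp x = Sum.inr (Fin.castLE htp i).succ) :
    (twinClass (HpTt p t T htp) x).card = T := by
  classical
  have h : twinClass (HpTt p t T htp) x = Finset.univ.filter
      (fun y => Sum.inr (Fin.castLE htp i).succ = twinProj p t T htp y) := by
    ext y
    simp [mem_twinClass_HpTt, hx]
  rw [h, Finset.card_filter, Fintype.sum_sum_type, Fintype.sum_sum_type, Fintype.sum_prod_type]
  simp only [twinProj, reduceCtorEq, if_false, Sum.inr.injEq, Fin.succ_inj, Fin.castLE_inj,
    Finset.sum_const, Finset.sum_ite_eq, Finset.card_univ, Fintype.card_fin, Finset.mem_univ,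
    if_true, smul_eq_mul, mul_ite, mul_one, mul_zero]
  omega

/-- The twin class of a vertex that is not duplicated is a singleton. -/
theorem card_twinClass_HpTt_of_not_duplicated {p t T : ℕ} {htp : t ≤ p}
    {x : Fin p ⊕ Fin (p + 1) ⊕ Fin t × Fin (T - 1)}
    (hx : ∀ i : Fin t, twinProj p t T htp x ≠ Sum.inr (Fin.castLE htp i).succ) :
    (twinClass (HpTt p t T htp) x).card = 1 := by
  refine Finset.card_eq_one.mpr ⟨x, ?_⟩
  ext y
  rw [mem_twinClass_HpTt, Finset.mem_singleton]
  refine ⟨fun h => ?_, fun h => h ▸ rfl⟩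
  rcases x with a | a | ⟨a, m⟩
  · rcases y with b | b | ⟨b, n⟩ <;> simp_all [twinProj]
  · rcases y with b | b | ⟨b, n⟩
    · simp [twinProj] at h
    · simp_all [twinProj]
    · exact (hx b h).elim
  · exact (hx a rfl).elim

theorem numBigTwinClasses_HpTt {p t T : ℕ} (htp : t ≤ p) (hT : 2 ≤ T) :
    numBigTwinClasses (HpTt p t T htp) = t := by
  classical
  let c : Fin t → Finset (Fin p ⊕ Fin (p + 1) ⊕ Fin t × Fin (T - 1)) :=
    fun i => twinClass (HpTt p t T htp) (Sum.inr (Sum.inl (Fin.castLE htp i).succ))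
  have hc : Function.Injective c := fun i j hij => by
    simpa [twinProj] using twinClass_HpTt_eq_iff.mp hij
  have himage : (Finset.univ.image (twinClass (HpTt p t T htp))).filter
      (fun Q => 2 ≤ Q.card) = Finset.univ.image c := by
    ext Q
    simp only [Finset.mem_filter, Finset.mem_image, Finset.mem_univ, true_and]
    constructor
    · rintro ⟨⟨x, rfl⟩, hx⟩
      by_contra hne
      rw [card_twinClass_HpTt_of_not_duplicated] at hx
      · omega
      · exact fun i hi => hne ⟨i, twinClass_HpTt_eq_iff.mpr hi.symm⟩
    · rintro ⟨i, rfl⟩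
      exact ⟨⟨_, rfl⟩, hT.trans_eq (card_twinClass_HpTt_of_duplicated (by omega) rfl).symm⟩
  calc numBigTwinClasses (HpTt p t T htp) = (Finset.univ.image c).card := by
        rw [← himage, numBigTwinClasses]
        congr!
    _ = t := by rw [Finset.card_image_of_injective _ hc, Finset.card_univ, Fintype.card_fin]

theorem maxTwinClass_HpTt {p t T : ℕ} (ht : 1 ≤ t) (htp : t ≤ p) (hT : 1 ≤ T) :
    maxTwinClass (HpTt p t T htp) = T := by
  refine le_antisymm (Finset.sup_le fun x _ => ?_) ?_
  · by_cases hx : ∃ i : Fin t, twinProj p t T htp x = Sum.inr (Fin.castLE htp i).succ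
    · exact (card_twinClass_HpTt_of_duplicated hT hx.choose_spec).le
    · exact (card_twinClass_HpTt_of_not_duplicated (not_exists.mp hx)).trans_le hT
  · let v : Fin p ⊕ Fin (p + 1) ⊕ Fin t × Fin (T - 1) :=
      Sum.inr (Sum.inl (Fin.castLE htp ⟨0, ht⟩).succ)
    calc T = (twinClass (HpTt p t T htp) v).card :=
          (card_twinClass_HpTt_of_duplicated hT rfl).symm
      _ ≤ maxTwinClass (HpTt p t T htp) :=
          Finset.le_sup (f := fun v => (twinClass (HpTt p t T htp) v).card) (Finset.mem_univ v)

/-- For all integers `p ≥ t ≥ 1` and `T ≥ 2`, the maximal twin-free induced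
subgraph `H_p^{(T,t)}\R` is isomorphic to `H_p`, and moreover
`t(H_p^{(T,t)}) = t` and `T(H_p^{(T,t)}) = T`. -/
theorem HpTt_quotient_and_twin_params (p t T : ℕ)
    (ht : 1 ≤ t) (htp : t ≤ p) (hT : 2 ≤ T) :
    (∀ s : Finset (Fin p ⊕ Fin (p + 1) ⊕ Fin t × Fin (T - 1)),
      IsRepSet (HpTt p t T htp) s →
        Nonempty ((HpTt p t T htp).induce
            (↑s : Set (Fin p ⊕ Fin (p + 1) ⊕ Fin t × Fin (T - 1)))
          ≃g Hp p)) ∧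
    numBigTwinClasses (HpTt p t T htp) = t ∧
    maxTwinClass (HpTt p t T htp) = T := by
  exact ⟨fun _ hs => nonempty_induce_HpTt_iso_Hp hs, numBigTwinClasses_HpTt htp hT,
    maxTwinClass_HpTt ht htp (by omega)⟩
end
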